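/- arXiv:2411.15670 — 2 statements merged into one kernel-verified Lean document; each statement's English description precedes it below -/
import Mathlib

section
/- Let n ≥ 1, let D ⊆ ℂⁿ be a nonempty open connected set, and let g : D → ℂ be holomorphic with g not identically zero. Set Z := { z ∈ D : g(z) = 0 }. Let h : D → ℂ be a function that is holomorphic on D \ Z and locally square-integrable on D, i.e. every point x ∈ D has an open neighborhood U ⊆ D with ∫_{U \ Z} |h|² dλ < ∞ (λ being Lebesgue measure on ℂⁿ ≅ ℝ^{2n}). Then there exists a holomorphic function H : D → ℂ with H(z) = h(z) for all z ∈ D \ Z. -/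
open MeasureTheory

section LocalExtension

open Set Filter Topology Metric

/-- The mean value inequality on discs, with a non-optimal constant. -/
theorem sq_mul_enorm_le_lintegral_ball {f : ℂ → ℂ} {w : ℂ} {R : ℝ} (hR : 0 < R)
    (hf : DifferentiableOn ℂ f (ball w R)) :
    ENNReal.ofReal (R ^ 2) * ‖f w‖ₑ ≤ ∫⁻ z in ball w R, ‖f z‖ₑ := by
  have key : ∀ ρ ∈ Ioo (R / 2) R, ENNReal.ofReal (2 * Real.pi) * ‖f w‖ₑ ≤
      ∫⁻ θ in Ioo (-Real.pi) Real.pi, ‖f (circleMap w ρ θ)‖ₑ := by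
    intro ρ hρ
    have h0 : 0 < ρ := by linarith [hρ.1]
    have h1 : Real.circleAverage f w ρ = f w := by
      apply DiffContOnCl.circleAverage
      rw [abs_of_pos h0]
      exact hf.diffContOnCl_ball (closedBall_subset_ball hρ.2)
    have h2 : (∫ θ in (-Real.pi)..Real.pi, f (circleMap w ρ θ)) = (2 * Real.pi) • f w := by
      rw [← h1, Real.circleAverage_def, smul_inv_smul₀ (by positivity)]
      have := ((periodic_circleMap w ρ).comp f).intervalIntegral_add_eq (-Real.pi) 0
      simp only [Function.comp_def] at this
      convert this using 2 <;> ring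
    have h3 := enorm_integral_le_lintegral_enorm (μ := volume.restrict (Ioc (-Real.pi) Real.pi))
      (fun θ => f (circleMap w ρ θ))
    rw [← intervalIntegral.integral_of_le (by linarith [Real.pi_pos]), h2, enorm_smul,
      restrict_Ioo_eq_restrict_Ioc.symm] at h3
    rwa [Real.enorm_of_nonneg (by positivity)] at h3
  have hmaps : MapsTo (fun p : ℝ × ℝ => circleMap w p.1 p.2)
      (Ioo (R / 2) R ×ˢ Ioo (-Real.pi) Real.pi) (ball w R) := by
    rintro ⟨ρ, θ⟩ ⟨h, -⟩
    simp only [mem_ball, dist_eq_norm, circleMap_sub_center, norm_circleMap_zero]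
    rw [abs_of_pos (by linarith [h.1])]
    exact h.2
  have hcont : Continuous (fun p : ℝ × ℝ => circleMap w p.1 p.2) := by
    unfold circleMap; fun_prop
  have hmeas : AEMeasurable (fun p : ℝ × ℝ => ‖f (circleMap w p.1 p.2)‖ₑ)
      (volume.restrict (Ioo (R / 2) R ×ˢ Ioo (-Real.pi) Real.pi)) :=
    ((hf.continuousOn.comp hcont.continuousOn hmaps).aemeasurable
      (measurableSet_Ioo.prod measurableSet_Ioo)).enorm
  calc ENNReal.ofReal (R ^ 2) * ‖f w‖ₑ
      ≤ ENNReal.ofReal (R / 2) *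
        (ENNReal.ofReal (2 * Real.pi) * ‖f w‖ₑ * ENNReal.ofReal (R - R / 2)) := by
        rw [show ∀ a b c d : ENNReal, a * (b * c * d) = (a * b * d) * c by intros; ring,
          ← ENNReal.ofReal_mul (by positivity), ← ENNReal.ofReal_mul (by positivity)]
        gcongr
        nlinarith [Real.pi_gt_three, sq_nonneg R]
    _ = ENNReal.ofReal (R / 2) * ∫⁻ _ in Ioo (R / 2) R,
          ENNReal.ofReal (2 * Real.pi) * ‖f w‖ₑ := by
        rw [setLIntegral_const, Real.volume_Ioo]
    _ ≤ ENNReal.ofReal (R / 2) * ∫⁻ ρ in Ioo (R / 2) R, ∫⁻ θ in Ioo (-Real.pi) Real.pi,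
          ‖f (circleMap w ρ θ)‖ₑ := by
        gcongr 1
        exact setLIntegral_mono' measurableSet_Ioo key
    _ = ENNReal.ofReal (R / 2) * ∫⁻ p in Ioo (R / 2) R ×ˢ Ioo (-Real.pi) Real.pi,
          ‖f (circleMap w p.1 p.2)‖ₑ := by
        rw [Measure.volume_eq_prod, setLIntegral_prod _ hmeas]
    _ = ∫⁻ p in Ioo (R / 2) R ×ˢ Ioo (-Real.pi) Real.pi,
          ENNReal.ofReal (R / 2) * ‖f (circleMap w p.1 p.2)‖ₑ := by
        rw [lintegral_const_mul'' _ hmeas]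
    _ ≤ ∫⁻ p in Ioo (R / 2) R ×ˢ Ioo (-Real.pi) Real.pi, ENNReal.ofReal p.1 •
          (ball w R).indicator (fun z => ‖f z‖ₑ) (w + Complex.polarCoord.symm p) := by
        refine setLIntegral_mono' (measurableSet_Ioo.prod measurableSet_Ioo) fun p hp => ?_
        have : w + Complex.polarCoord.symm p = circleMap w p.1 p.2 := by
          rw [Complex.polarCoord_symm_apply, circleMap, Complex.exp_mul_I]; push_cast; rfl
        rw [this, indicator_of_mem (hmaps hp), smul_eq_mul]
        gcongr
        exact hp.1.1.le
    _ ≤ ∫⁻ p in polarCoord.target, ENNReal.ofReal p.1 •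
          (ball w R).indicator (fun z => ‖f z‖ₑ) (w + Complex.polarCoord.symm p) := by
        refine lintegral_mono_set (prod_mono ?_ subset_rfl)
        intro ρ hρ
        exact lt_trans (by positivity) hρ.1
    _ = ∫⁻ z in ball w R, ‖f z‖ₑ := by
        rw [Complex.lintegral_comp_polarCoord_symm
          (fun z => (ball w R).indicator (fun z => ‖f z‖ₑ) (w + z)),
          lintegral_add_left_eq_self _ w, lintegral_indicator measurableSet_ball]

/-- An isolated singularity at which a holomorphic function of one variable is square-integrable is
removable. -/
theorem exists_differentiableOn_of_lintegral_sq_ne_top {f : ℂ → ℂ} {c : ℂ} {R : ℝ} (hR : 0 < R)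
    (hf : DifferentiableOn ℂ f (ball c R \ {c}))
    (hint : ∫⁻ z in ball c R \ {c}, ‖f z‖ₑ ^ 2 ≠ ⊤) :
    ∃ F : ℂ → ℂ, DifferentiableOn ℂ F (ball c R) ∧ EqOn F f (ball c R \ {c}) := by
  refine ⟨Function.update f c (limUnder (𝓝[≠] c) f),
    Complex.differentiableOn_update_limUnder_of_isLittleO (ball_mem_nhds c hR) hf ?_,
    fun z hz => Function.update_of_ne hz.2 _ _⟩
  have hlim : Tendsto (fun s => ∫⁻ z in ball c s, ‖f z‖ₑ ^ 2
      ∂(volume.restrict (ball c R \ {c}))) (𝓝 0) (𝓝 0) := by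
    refine tendsto_setLIntegral_zero hint ?_
    refine tendsto_of_tendsto_of_tendsto_of_le_of_le tendsto_const_nhds (h := fun s =>
      volume (ball c s)) ?_ (fun _ => zero_le) (fun s => Measure.restrict_apply_le _ _)
    simp only [Complex.volume_ball]
    have : Tendsto (fun s : ℝ => ENNReal.ofReal s ^ 2 * (NNReal.pi : ENNReal)) (𝓝 0)
      (𝓝 (ENNReal.ofReal 0 ^ 2 * (NNReal.pi : ENNReal))) :=
      ENNReal.Tendsto.mul_const (ENNReal.Tendsto.pow (ENNReal.tendsto_ofReal tendsto_id))
        (Or.inr ENNReal.coe_ne_top)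
    simpa using this
  have hinv : Tendsto (fun z : ℂ => ‖(z - c)⁻¹‖) (𝓝[≠] c) atTop := by
    have : Tendsto (fun z : ℂ => z - c) (𝓝[≠] c) (𝓝[≠] 0) := by
      refine tendsto_nhdsWithin_iff.2 ⟨?_, eventually_mem_nhdsWithin.mono fun z hz =>
        sub_ne_zero.2 hz⟩
      have : Tendsto (fun z : ℂ => z - c) (𝓝 c) (𝓝 (c - c)) := Continuous.tendsto (by fun_prop) c
      rw [sub_self] at this
      exact this.mono_left nhdsWithin_le_nhds
    exact (tendsto_norm_inv_nhdsNE_zero_atTop).comp this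
  refine Asymptotics.IsLittleO.sub ?_ ?_
  swap
  · exact (Asymptotics.isLittleO_const_left.2 (Or.inr hinv))
  rw [Asymptotics.isLittleO_iff]
  intro ε hε
  have hdist : Tendsto (fun z => 2 * dist z c) (𝓝[≠] c) (𝓝 0) := by
    have : Tendsto (fun z => 2 * dist z c) (𝓝 c) (𝓝 (2 * dist c c)) :=
      Continuous.tendsto (by fun_prop) c
    rw [dist_self, mul_zero] at this
    exact this.mono_left nhdsWithin_le_nhds
  have hev := (hlim.comp hdist).eventually (ge_mem_nhds
    (show (0 : ENNReal) < ENNReal.ofReal (ε ^ 2) by positivity))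
  filter_upwards [hev, eventually_mem_nhdsWithin, hdist.eventually (gt_mem_nhds hR)]
    with z hz hzc hzR
  have hpos : 0 < dist z c := dist_pos.2 hzc
  have hsub : ball z (dist z c) ⊆ ball c (2 * dist z c) ∩ (ball c R \ {c}) := by
    intro y hy
    have h1 : dist y z < dist z c := hy
    have h2 := dist_triangle y z c
    refine ⟨by rw [mem_ball]; linarith, by rw [mem_ball]; linarith, ?_⟩
    rintro rfl
    rw [dist_comm] at h1
    exact lt_irrefl _ h1
  have hle := sq_mul_enorm_le_lintegral_ball hpos (f := fun y => f y ^ 2)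
    ((hf.mono (hsub.trans inter_subset_right)).pow 2)
  simp only [enorm_pow] at hle
  have hle2 := (hle.trans (lintegral_mono_set hsub))
  rw [← Measure.restrict_restrict measurableSet_ball] at hle2
  have hle3 := hle2.trans hz
  rw [← ofReal_norm, ← ENNReal.ofReal_pow (norm_nonneg _),
    ← ENNReal.ofReal_mul (by positivity), ENNReal.ofReal_le_ofReal_iff (by positivity),
    ← mul_pow, pow_le_pow_iff_left₀ (by positivity) hε.le (by norm_num)] at hle3
  rw [norm_inv, ← dist_eq_norm, ← div_eq_mul_inv, le_div_iff₀ hpos, mul_comm]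
  exact hle3

/-- Local holomorphic extensions of a function defined on a dense subset glue to a global one. -/
theorem exists_differentiableOn_of_local {E : Type*} [NormedAddCommGroup E] [NormedSpace ℂ E]
    {f : E → ℂ} {D S : Set E} (hD : IsOpen D) (hSD : S ⊆ D) (hDS : D ⊆ closure S)
    (hloc : ∀ x ∈ D, ∃ U ∈ 𝓝 x, ∃ F : E → ℂ, DifferentiableOn ℂ F U ∧ EqOn F f (U ∩ S)) :
    ∃ H : E → ℂ, DifferentiableOn ℂ H D ∧ EqOn H f S := by
  have key : ∀ x ∈ D, ∃ U, IsOpen U ∧ x ∈ U ∧ ∃ F : E → ℂ, DifferentiableOn ℂ F U ∧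
      EqOn F f (U ∩ S) ∧ EqOn (fun y => limUnder (𝓝[S] y) f) F U := by
    intro x hx
    obtain ⟨U, hU, F, hF, hFf⟩ := hloc x hx
    obtain ⟨V, hVU, hV, hxV⟩ := _root_.mem_nhds_iff.1 (inter_mem hU (hD.mem_nhds hx))
    rw [subset_inter_iff] at hVU
    refine ⟨V, hV, hxV, F, hF.mono hVU.1, hFf.mono (inter_subset_inter_left _ hVU.1), ?_⟩
    intro y hy
    have : (𝓝[S] y).NeBot := mem_closure_iff_nhdsWithin_neBot.1 (hDS (hVU.2 hy))
    refine Tendsto.limUnder_eq ?_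
    have h1 : Tendsto F (𝓝[S] y) (𝓝 (F y)) :=
      (((hF.mono hVU.1).continuousOn.continuousAt (hV.mem_nhds hy)).tendsto).mono_left
        nhdsWithin_le_nhds
    refine h1.congr' ?_
    filter_upwards [nhdsWithin_le_nhds (hV.mem_nhds hy), self_mem_nhdsWithin] with z hz hzS
    exact hFf ⟨hVU.1 hz, hzS⟩
  refine ⟨fun y => limUnder (𝓝[S] y) f, fun x hx => ?_, fun x hx => ?_⟩
  · obtain ⟨U, hU, hxU, F, hF, -, hE⟩ := key x hx
    exact ((hF.congr hE).differentiableAt (hU.mem_nhds hxU)).differentiableWithinAt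
  · obtain ⟨U, hU, hxU, F, -, hFf, hE⟩ := key x (hSD hx)
    exact (hE hxU).trans (hFf ⟨hxU, hx⟩)

/-- Averaging a holomorphic function over translates of a fixed circle in a complex line yields a
holomorphic function. -/
theorem differentiableAt_circleAverage_translate {E : Type*} [NormedAddCommGroup E]
    [NormedSpace ℂ E] [FiniteDimensional ℂ E] {h : E → ℂ} {V : Set E} (hV : IsOpen V)
    (hh : DifferentiableOn ℂ h V) {x v : E} {r : ℝ}
    (hx : ∀ t ∈ sphere (0 : ℂ) |r|, x + t • v ∈ V) :
    DifferentiableAt ℂ (fun z => Real.circleAverage (fun t => h (z + t • v)) 0 r) x := by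
  have : ProperSpace E := FiniteDimensional.proper ℂ E
  have : ProperSpace (E →L[ℂ] ℂ) := FiniteDimensional.proper ℂ _
  borelize E
  have hev : ∀ᶠ z in 𝓝 x, ∀ t ∈ sphere (0 : ℂ) |r|, z + t • v ∈ V := by
    refine (isCompact_sphere (0 : ℂ) |r|).eventually_forall_of_forall_eventually fun t ht => ?_
    have hc : Continuous fun p : E × ℂ => p.1 + p.2 • v := by fun_prop
    exact hc.continuousAt.eventually (hV.mem_nhds (hx t ht))
  obtain ⟨ε, hε, hεV⟩ := nhds_basis_closedBall.eventually_iff.1 hev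
  have hK : IsCompact (closedBall x ε ×ˢ sphere (0 : ℂ) |r|) :=
    (isCompact_closedBall x ε).prod (isCompact_sphere 0 |r|)
  have hcont : ContinuousOn (fun p : E × ℂ => h (p.1 + p.2 • v))
      (closedBall x ε ×ˢ sphere (0 : ℂ) |r|) :=
    hh.continuousOn.comp (by fun_prop) fun p hp => hεV hp.1 p.2 hp.2
  obtain ⟨M, hM⟩ := hK.exists_bound_of_continuousOn hcont
  have hcirc : ∀ θ : ℝ, circleMap 0 r θ ∈ sphere (0 : ℂ) |r| := fun θ =>
    circleMap_mem_sphere' 0 r θ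
  have hmem : ∀ z ∈ closedBall x ε, ∀ θ : ℝ, z + circleMap 0 r θ • v ∈ V := fun z hz θ =>
    hεV hz _ (hcirc θ)
  have hcz : ∀ z ∈ closedBall x ε, Continuous fun θ : ℝ => h (z + circleMap 0 r θ • v) := by
    intro z hz
    have := continuous_circleMap 0 r
    exact hh.continuousOn.comp_continuous (by fun_prop) (hmem z hz)
  have hbound : ∀ z ∈ ball x (ε / 2), ∀ θ : ℝ,
      ‖fderiv ℂ h (z + circleMap 0 r θ • v)‖ ≤ 2 * M / (ε / 2) := by
    intro z hz θ
    have hz' : z ∈ closedBall x ε := by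
      rw [mem_closedBall]; rw [mem_ball] at hz; linarith
    have hw : ∀ w ∈ ball (z + circleMap 0 r θ • v) (ε / 2),
        w - circleMap 0 r θ • v ∈ closedBall x ε := by
      intro w hw
      have h1 : dist (w - circleMap 0 r θ • v) z < ε / 2 := by
        rw [mem_ball, dist_eq_norm] at hw
        rw [dist_eq_norm]
        convert hw using 2
        abel
      have := dist_triangle (w - circleMap 0 r θ • v) z x
      rw [mem_ball] at hz
      rw [mem_closedBall]
      linarith
    refine Complex.norm_fderiv_le_div_of_mapsTo_ball (hh.mono fun w hwb => ?_)
      (fun w hwb => ?_) (by positivity)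
    · simpa using hmem _ (hw w hwb) θ
    · rw [mem_closedBall, dist_eq_norm]
      refine (norm_sub_le _ _).trans ?_
      have h1 := hM (_, _) (mk_mem_prod (hw w hwb) (hcirc θ))
      have h2 := hM (_, _) (mk_mem_prod hz' (hcirc θ))
      simp only [sub_add_cancel] at h1
      linarith
  have main := intervalIntegral.hasFDerivAt_integral_of_dominated_of_fderiv_le (𝕜 := ℂ)
    (μ := volume) (a := 0) (b := 2 * Real.pi) (s := ball x (ε / 2)) (x₀ := x)
    (F := fun z θ => h (z + circleMap 0 r θ • v))
    (F' := fun z θ => fderiv ℂ h (z + circleMap 0 r θ • v))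
    (bound := fun _ => 2 * M / (ε / 2)) (ball_mem_nhds x (by positivity))
    (by
      filter_upwards [closedBall_mem_nhds x hε] with z hz
      exact (hcz z hz).aestronglyMeasurable)
    ((hcz x (mem_closedBall_self hε.le)).intervalIntegrable _ _)
    (by
      have hm : Measurable fun θ : ℝ => x + circleMap 0 r θ • v := by
        have := continuous_circleMap 0 r
        exact Continuous.measurable (by fun_prop)
      exact ((measurable_fderiv ℂ h).comp hm).aestronglyMeasurable)
    (ae_of_all _ fun θ _ z hz => hbound z hz θ)
    intervalIntegrable_const
    (ae_of_all _ fun θ _ z hz => by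
      have hz' : z ∈ closedBall x ε := by
        rw [mem_closedBall]; rw [mem_ball] at hz; linarith
      exact (hasFDerivAt_comp_add_right _).2
        (hh.differentiableAt (hV.mem_nhds (hmem z hz' θ))).hasFDerivAt)
  exact main.differentiableAt.const_smul ((2 * Real.pi)⁻¹ : ℝ)

/-- The identity theorem on convex open sets, for functions of several variables. -/
theorem eqOn_zero_of_convex_of_eventuallyEq_zero {E : Type*} [NormedAddCommGroup E]
    [NormedSpace ℂ E] {g : E → ℂ} {W : Set E} (hW : IsOpen W) (hWc : Convex ℝ W)
    (hg : DifferentiableOn ℂ g W) {y : E} (hy : y ∈ W) (h0 : g =ᶠ[𝓝 y] 0) : EqOn g 0 W := by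
  intro z hz
  let l : ℂ → E := fun t => y + t • (z - y)
  have hl : Differentiable ℂ l := by fun_prop
  have hopen : IsOpen (l ⁻¹' W) := hW.preimage hl.continuous
  have hconv : Convex ℝ (l ⁻¹' W) := by
    intro s hs t ht a b ha hb hab
    have : l (a • s + b • t) = a • l s + b • l t := by
      have hb' : b = 1 - a := by linarith
      subst hb'
      simp only [l, ← Complex.coe_smul]
      push_cast
      module
    rw [mem_preimage, this]
    exact hWc hs ht ha hb hab
  have han : AnalyticOnNhd ℂ (g ∘ l) (l ⁻¹' W) :=
    (hg.comp hl.differentiableOn (mapsTo_preimage l W)).analyticOnNhd hopen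
  have hl0 : l 0 = y := by simp [l]
  have hl1 : l 1 = z := by simp [l]
  have := han.eqOn_zero_of_preconnected_of_eventuallyEq_zero hconv.isPreconnected
    (z₀ := 0) (by rwa [mem_preimage, hl0])
    ((hl.continuous.tendsto' 0 y hl0).eventually h0)
  have h1 := this (x := 1) (by rwa [mem_preimage, hl1])
  simpa [hl1] using h1

/-- The complement of the zero set of a nonzero holomorphic function is dense. -/
theorem subset_closure_ne_zero {E : Type*} [NormedAddCommGroup E]
    [NormedSpace ℂ E] {g : E → ℂ} {D : Set E} (hD : IsOpen D) (hDc : IsPreconnected D)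
    (hg : DifferentiableOn ℂ g D) (hne : ∃ z ∈ D, g z ≠ 0) :
    D ⊆ closure {z ∈ D | g z ≠ 0} := by
  obtain ⟨z₀, hz₀, hgz₀⟩ := hne
  by_contra hcon
  obtain ⟨x, hx, hxc⟩ := not_subset.1 hcon
  have hsub : D ⊆ {y | ∀ᶠ z in 𝓝 y, g z = 0} := by
    refine hDc.subset_of_closure_inter_subset isOpen_setOfPred_eventually_nhds ⟨x, hx, ?_⟩ ?_
    · filter_upwards [hD.mem_nhds hx, isClosed_closure.isOpen_compl.mem_nhds hxc] with z hz hzc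
      by_contra h
      exact hzc (subset_closure ⟨hz, h⟩)
    · rintro y ⟨hyc, hy⟩
      obtain ⟨ρ, hρ, hball⟩ := Metric.isOpen_iff.1 hD y hy
      obtain ⟨w, hw, hwy⟩ := mem_closure_iff.1 hyc ρ hρ
      have := eqOn_zero_of_convex_of_eventuallyEq_zero isOpen_ball (convex_ball y ρ)
        (hg.mono hball) (y := w) (by rwa [mem_ball, dist_comm]) hw
      filter_upwards [ball_mem_nhds y hρ] with z hz using this hz
  exact hgz₀ (hsub hz₀).self_of_nhds

/-- The mean value property for a square-integrable function which is holomorphic off the zeros of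
another holomorphic function. -/
theorem circleAverage_eq_of_lintegral_sq_ne_top {φ γ : ℂ → ℂ} {r R : ℝ} (hr : 0 < r)
    (hrR : r < R) (hγ : DifferentiableOn ℂ γ (ball 0 R))
    (hφ : DifferentiableOn ℂ φ {t ∈ ball 0 R | γ t ≠ 0})
    (hint : ∫⁻ t in {t ∈ ball 0 R | γ t ≠ 0}, ‖φ t‖ₑ ^ 2 ≠ ⊤)
    (hne : ∀ t ∈ sphere (0 : ℂ) r, γ t ≠ 0) (h0 : γ 0 ≠ 0) :
    Real.circleAverage φ 0 r = φ 0 := by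
  have h0mem : (0 : ℂ) ∈ ball (0 : ℂ) R := mem_ball_self (hr.trans hrR)
  have hclos := subset_closure_ne_zero isOpen_ball (convex_ball (0 : ℂ) R).isPreconnected hγ
    ⟨0, h0mem, h0⟩
  have hopen : IsOpen {t ∈ ball (0 : ℂ) R | γ t ≠ 0} :=
    hγ.continuousOn.isOpen_inter_preimage isOpen_ball isOpen_ne
  obtain ⟨H, hH, hHφ⟩ := exists_differentiableOn_of_local (f := φ) isOpen_ball
    (fun t ht => ht.1) hclos (by
      intro x hx
      have han : AnalyticAt ℂ γ x := hγ.analyticAt (isOpen_ball.mem_nhds hx)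
      by_cases hγx : γ x = 0
      swap
      · exact ⟨_, hopen.mem_nhds ⟨hx, hγx⟩, φ, hφ, fun _ _ => rfl⟩
      have hev : ∀ᶠ z in 𝓝[≠] x, z ∈ {t ∈ ball 0 R | γ t ≠ 0} := by
        rcases han.eventually_eq_zero_or_eventually_ne_zero with h | h
        · obtain ⟨z, hz, hz'⟩ := mem_closure_iff_nhds.1 (hclos hx) _ h
          exact absurd hz hz'.2
        · filter_upwards [h, nhdsWithin_le_nhds (isOpen_ball.mem_nhds hx)] with z hz hzb
          exact ⟨hzb, hz⟩
      obtain ⟨δ, hδ, hδs⟩ := mem_nhdsWithin_iff.1 hev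
      rw [← sdiff_eq] at hδs
      obtain ⟨F, hF, hFφ⟩ := exists_differentiableOn_of_lintegral_sq_ne_top hδ (hφ.mono hδs)
        (ne_top_of_le_ne_top hint (lintegral_mono_set hδs))
      refine ⟨ball x δ, ball_mem_nhds x hδ, F, hF, fun z hz => hFφ ⟨hz.1, ?_⟩⟩
      rintro rfl
      exact hz.2.2 hγx)
  rw [← hHφ ⟨h0mem, h0⟩, ← (hH.diffContOnCl_ball (c := 0) (R := |r|) ?_).circleAverage]
  · refine Real.circleAverage_congr_sphere fun t ht => (hHφ ⟨?_, hne t ?_⟩).symm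
    all_goals rw [abs_of_pos hr] at ht
    · exact sphere_subset_closedBall.trans (closedBall_subset_ball hrR) ht
    · exact ht
  · rw [abs_of_pos hr]; exact closedBall_subset_ball hrR

/-- An integrable function is integrable along almost every translate of a bounded piece of a complex
line. -/
theorem ae_lintegral_translate_ne_top {E : Type*} [NormedAddCommGroup E] [NormedSpace ℂ E]
    [FiniteDimensional ℂ E] [MeasurableSpace E] [BorelSpace E] (μ : Measure E)
    [μ.IsAddHaarMeasure] {G : E → ENNReal} (hG : Measurable G) (hint : ∫⁻ z, G z ∂μ ≠ ⊤)
    (v : E) {K : Set ℂ} (hK : volume K ≠ ⊤) :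
    ∀ᵐ z ∂μ, ∫⁻ t in K, G (z + t • v) ≠ ⊤ := by
  have : ProperSpace E := FiniteDimensional.proper ℂ E
  have hm : Measurable fun p : E × ℂ => G (p.1 + p.2 • v) :=
    hG.comp (Continuous.measurable (by fun_prop))
  have hfin : ∫⁻ z, (∫⁻ t in K, G (z + t • v)) ∂μ ≠ ⊤ := by
    rw [lintegral_lintegral_swap hm.aemeasurable]
    simp only [lintegral_add_right_eq_self, setLIntegral_const]
    exact ENNReal.mul_ne_top hint hK
  filter_upwards [ae_lt_top hm.lintegral_prod_right' hfin] with z hz using hz.ne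

/-- Local form of the extension theorem: near `x`, the extension is the average over small circles
in a complex line on which `g` does not vanish identically. -/
theorem exists_local_extension {E : Type*} [NormedAddCommGroup E] [NormedSpace ℂ E]
    [FiniteDimensional ℂ E] [MeasurableSpace E] [BorelSpace E] (μ : Measure E)
    [μ.IsAddHaarMeasure] {g h : E → ℂ} {U : Set E} (hU : IsOpen U)
    (hg : DifferentiableOn ℂ g U) (hh : DifferentiableOn ℂ h {z ∈ U | g z ≠ 0})
    (hint : ∫⁻ z in {z ∈ U | g z ≠ 0}, ‖h z‖ₑ ^ 2 ∂μ ≠ ⊤) {x : E} (hx : x ∈ U)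
    (hxc : x ∈ closure {z | g z ≠ 0}) :
    ∃ N ∈ 𝓝 x, ∃ F : E → ℂ, DifferentiableOn ℂ F N ∧ EqOn F h (N ∩ {z ∈ U | g z ≠ 0}) := by
  set S : Set E := {z ∈ U | g z ≠ 0} with hS
  have hSo : IsOpen S := hg.continuousOn.isOpen_inter_preimage hU isOpen_ne
  obtain ⟨ρ, hρ, hρU⟩ := Metric.isOpen_iff.1 hU x hx
  obtain ⟨y, hgy, hxy⟩ := Metric.mem_closure_iff.1 hxc (ρ / 2) (by positivity)
  set v := y - x with hv
  have hvρ : ‖v‖ < ρ / 2 := by rwa [hv, ← dist_eq_norm, dist_comm]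
  have hline : ∀ t ∈ ball (0 : ℂ) 2, x + t • v ∈ U := by
    intro t ht
    apply hρU
    rw [mem_ball_zero_iff] at ht
    rw [mem_ball, dist_eq_norm, add_sub_cancel_left, norm_smul]
    nlinarith [norm_nonneg v, norm_nonneg t]
  have hgl : DifferentiableOn ℂ (fun t : ℂ => g (x + t • v)) (ball 0 2) :=
    hg.comp (by fun_prop) hline
  have hne : ∀ᶠ t in 𝓝[≠] (0 : ℂ), g (x + t • v) ≠ 0 := by
    have han : AnalyticAt ℂ (fun t : ℂ => g (x + t • v)) 0 :=
      hgl.analyticAt (ball_mem_nhds 0 two_pos)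
    refine han.eventually_eq_zero_or_eventually_ne_zero.resolve_left fun h => hgy ?_
    have := eqOn_zero_of_convex_of_eventuallyEq_zero isOpen_ball (convex_ball 0 2) hgl
      (mem_ball_self two_pos) h (x := 1) (by simp)
    simpa [hv] using this
  obtain ⟨δ, hδ, hδs⟩ := mem_nhdsWithin_iff.1 hne
  obtain ⟨R, hR, hRδ⟩ : ∃ R : ℝ, 0 < R ∧ R < min δ 2 := exists_between (by positivity)
  have hr : 0 < R / 2 := by positivity
  have hrR : R / 2 < R := by linarith
  have hcont : Continuous fun p : E × ℂ => p.1 + p.2 • v := by fun_prop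
  have hevU : ∀ᶠ z in 𝓝 x, ∀ t ∈ closedBall (0 : ℂ) R, z + t • v ∈ U := by
    refine (isCompact_closedBall 0 R).eventually_forall_of_forall_eventually fun t ht => ?_
    refine hcont.continuousAt.eventually (hU.mem_nhds (hline t ?_))
    exact closedBall_subset_ball (hRδ.trans_le (min_le_right _ _)) ht
  have hevS : ∀ᶠ z in 𝓝 x, ∀ t ∈ sphere (0 : ℂ) (R / 2), z + t • v ∈ S := by
    refine (isCompact_sphere 0 (R / 2)).eventually_forall_of_forall_eventually fun t ht => ?_
    have ht' : t ∈ ball (0 : ℂ) (min δ 2) :=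
      sphere_subset_closedBall.trans (closedBall_subset_ball (hrR.trans hRδ)) ht
    refine hcont.continuousAt.eventually (hSo.mem_nhds ⟨hline t ?_, hδs ⟨?_, ?_⟩⟩)
    · exact ball_subset_ball (min_le_right _ _) ht'
    · exact ball_subset_ball (min_le_left _ _) ht'
    · exact ne_of_mem_sphere ht hr.ne'
  obtain ⟨N, hN, hNo, hxN⟩ := _root_.eventually_nhds_iff.1 (hevU.and hevS)
  have hF : DifferentiableOn ℂ
      (fun z => Real.circleAverage (fun t : ℂ => h (z + t • v)) 0 (R / 2)) N := fun z hz =>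
    (differentiableAt_circleAverage_translate hSo hh (by
      rw [abs_of_pos hr]; exact (hN z hz).2)).differentiableWithinAt
  refine ⟨N, hNo.mem_nhds hxN, _, hF, ?_⟩
  refine Measure.eqOn_open_of_ae_eq (μ := μ) ?_ (hNo.inter hSo)
    (hF.continuousOn.mono inter_subset_left) (hh.continuousOn.mono inter_subset_right)
  have hGm : Measurable (S.indicator fun z => ‖h z‖ₑ ^ 2) := by
    classical
    have : Measurable (S.piecewise h 0) :=
      hh.continuousOn.measurable_piecewise continuousOn_const hSo.measurableSet
    convert (this.enorm.pow_const 2) using 1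
    ext z
    by_cases hz : z ∈ S <;> simp [hz]
  have hae := ae_lintegral_translate_ne_top μ hGm
    (by rwa [lintegral_indicator hSo.measurableSet]) v
    (measure_ball_lt_top (x := (0 : ℂ)) (r := R)).ne
  refine (ae_restrict_iff' (hNo.inter hSo).measurableSet).2 ?_
  filter_upwards [hae] with z hz ⟨hzN, hzS⟩
  have hmaps : ∀ t ∈ ball (0 : ℂ) R, z + t • v ∈ U := fun t ht =>
    (hN z hzN).1 t (ball_subset_closedBall ht)
  have hgz : DifferentiableOn ℂ (fun t : ℂ => g (z + t • v)) (ball 0 R) :=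
    hg.comp (by fun_prop) hmaps
  have hTo : IsOpen {t ∈ ball (0 : ℂ) R | g (z + t • v) ≠ 0} :=
    hgz.continuousOn.isOpen_inter_preimage isOpen_ball isOpen_ne
  have := circleAverage_eq_of_lintegral_sq_ne_top (φ := fun t : ℂ => h (z + t • v))
    (γ := fun t : ℂ => g (z + t • v)) hr hrR hgz
    (hh.comp (by fun_prop) fun t ht => ⟨hmaps t ht.1, ht.2⟩)
    (by
      refine ne_top_of_le_ne_top hz ?_
      refine le_trans (le_of_eq ?_) (lintegral_mono_set (sep_subset _ fun t => g (z + t • v) ≠ 0))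
      refine setLIntegral_congr_fun hTo.measurableSet fun t ht => ?_
      exact (indicator_of_mem (s := S) ⟨hmaps t ht.1, ht.2⟩ (fun z => ‖h z‖ₑ ^ 2)).symm)
    (fun t ht => ((hN z hzN).2 t ht).2) (by simpa using hzS.2)
  simpa using this

end LocalExtension

/-- **L²-negligibility of the zero set of a holomorphic function.**
If `h` is holomorphic on `D \ Z`, where `Z` is the zero set in `D` of a
holomorphic function `g ≢ 0`, and `h` is locally square-integrable on `D`,
then `h` extends holomorphically across `Z`. -/
theorem holomorphic_extension_across_zero_set
    (n : ℕ) (hn : 1 ≤ n) (D : Set (Fin n → ℂ)) (hD : IsOpen D)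
    (hDne : D.Nonempty) (hDconn : IsConnected D)
    (g : (Fin n → ℂ) → ℂ) (hg : DifferentiableOn ℂ g D)
    (hgne : ∃ z ∈ D, g z ≠ 0)
    (h : (Fin n → ℂ) → ℂ)
    (hh : DifferentiableOn ℂ h (D \ {z ∈ D | g z = 0}))
    (hL2 : ∀ x ∈ D, ∃ U : Set (Fin n → ℂ), IsOpen U ∧ x ∈ U ∧ U ⊆ D ∧
      IntegrableOn (fun z => ‖h z‖ ^ 2) (U \ {z ∈ D | g z = 0}) volume) :
    ∃ H : (Fin n → ℂ) → ℂ, DifferentiableOn ℂ H D ∧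
      ∀ z ∈ D \ {z ∈ D | g z = 0}, H z = h z := by
  have hset : ∀ U ⊆ D, U \ {z ∈ D | g z = 0} = {z ∈ U | g z ≠ 0} := by
    intro U hU
    ext z
    exact ⟨fun hz => ⟨hz.1, fun h0 => hz.2 ⟨hU hz.1, h0⟩⟩, fun hz => ⟨hz.1, fun h0 => hz.2 h0.2⟩⟩
  rw [hset D Set.Subset.rfl] at hh ⊢
  have hclos := subset_closure_ne_zero hD hDconn.isPreconnected hg hgne
  refine exists_differentiableOn_of_local hD (fun z hz => hz.1) hclos fun x hx => ?_
  obtain ⟨U, hU, hxU, hUD, hint⟩ := hL2 x hx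
  rw [hset U hUD] at hint
  obtain ⟨N, hN, F, hF, hFh⟩ := exists_local_extension volume hU (hg.mono hUD)
    (hh.mono fun z hz => ⟨hUD hz.1, hz.2⟩)
    (by simpa [enorm_pow, HasFiniteIntegral] using hint.hasFiniteIntegral.ne) hxU
    (closure_mono (fun z hz => hz.2) (hclos hx))
  refine ⟨N ∩ U, Filter.inter_mem hN (hU.mem_nhds hxU), F, hF.mono Set.inter_subset_left, ?_⟩
  rintro z ⟨⟨hzN, hzU⟩, hzS⟩
  exact hFh ⟨hzN, hzU, hzS.2⟩
end

section
/- Let n ≥ 1, let D ⊆ ℂⁿ be a nonempty open connected set, let φ : D → ℝ be upper semicontinuous, let g : D → ℂ and f : D → ℂ be holomorphic with g not identically zero, and let ε > 0 be real. Set Z := { z ∈ D : g(z) = 0 } and suppose ∫_{D \ Z} |f(z)|² e^{−φ(z)} |g(z)|^{−2(1+ε)} dλ(z) < ∞, where λ is Lebesgue measure on ℂⁿ ≅ ℝ^{2n}. Then there exists a holomorphic function H : D → ℂ such that H(z)·g(z) = f(z) for all z ∈ D and ∫_{D \ Z} |H(z)|² e^{−φ(z)} |g(z)|^{−2ε} dλ(z)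 = ∫_{D \ Z} |f(z)|² e^{−φ(z)} |g(z)|^{−2(1+ε)} dλ(z); in particular the left-hand integral is finite. -/
open MeasureTheory

open Filter Topology Metric Set in
/-- A meromorphic function that is square integrable near a point has no pole there. -/
theorem meromorphicOrderAt_nonneg_of_lintegral_sq_ne_top {h : ℂ → ℂ} {z₀ : ℂ} {s : Set ℂ}
    (hh : MeromorphicAt h z₀) (hs : s ∈ 𝓝 z₀) (hint : ∫⁻ z in s, ‖h z‖ₑ ^ 2 ≠ ⊤) :
    0 ≤ meromorphicOrderAt h z₀ := by
  by_contra! hneg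
  have hlin : MeromorphicAt (fun z => z - z₀) z₀ := by fun_prop
  have hone : meromorphicOrderAt (fun z => z - z₀) z₀ = 1 := by simp
  have hord : 0 ≤ meromorphicOrderAt ((h * fun z => z - z₀)⁻¹) z₀ := by
    rw [meromorphicOrderAt_inv, meromorphicOrderAt_mul hh hlin, hone]
    cases ho : meromorphicOrderAt h z₀ with
    | top => simp [ho] at hneg
    | coe m =>
      rw [ho] at hneg
      have hm : m < 0 := by exact_mod_cast hneg
      have : (0 : ℤ) ≤ -(m + 1) := by omega
      exact_mod_cast this
  obtain ⟨L, hL⟩ := tendsto_nhds_of_meromorphicOrderAt_nonneg (hh.mul hlin).inv hord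
  obtain ⟨C, hC, hCb⟩ : ∃ C > 0, ∀ᶠ z in 𝓝[≠] z₀, 1 ≤ C * (‖h z‖ * ‖z - z₀‖) := by
    refine ⟨‖L‖ + 1, by positivity, ?_⟩
    have hne : ∀ᶠ z in 𝓝[≠] z₀, h z ≠ 0 :=
      (tendsto_cobounded_of_meromorphicOrderAt_neg hneg).eventually_ne_cobounded 0
    filter_upwards [hL.norm.eventually (gt_mem_nhds (lt_add_one ‖L‖)), hne,
      self_mem_nhdsWithin] with z hz h1 h2
    have h3 : 0 < ‖h z‖ * ‖z - z₀‖ :=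
      mul_pos (norm_pos_iff.2 h1) (norm_pos_iff.2 (sub_ne_zero.2 h2))
    simp only [Pi.inv_apply, Pi.mul_apply, norm_inv, norm_mul] at hz
    rw [inv_lt_iff_one_lt_mul₀ h3] at hz
    linarith
  obtain ⟨r, hr, hrb⟩ : ∃ r > 0, ∀ z ∈ ball z₀ r, z ∈ s ∧ (z ≠ z₀ → 1 ≤ C * (‖h z‖ * ‖z - z₀‖)) :=
    Metric.eventually_nhds_iff_ball.1
      ((eventually_mem_set.2 hs).and (eventually_nhdsWithin_iff.1 hCb))
  have hball : ∀ t ∈ Ioo 0 r, ENNReal.ofReal (C⁻¹ ^ 2 * Real.pi) ≤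
      ∫⁻ z in ball z₀ t, ‖h z‖ₑ ^ 2 ∂(volume.restrict s) := by
    intro t ht
    have hts : ball z₀ t ⊆ s := fun z hz => (hrb z (ball_subset_ball ht.2.le hz)).1
    rw [Measure.restrict_restrict_of_subset hts]
    calc ENNReal.ofReal (C⁻¹ ^ 2 * Real.pi)
        = ∫⁻ z in ball z₀ t, ENNReal.ofReal ((C * t)⁻¹ ^ 2) := by
          rw [setLIntegral_const, Complex.volume_ball, ← ENNReal.ofReal_pow ht.1.le,
            ← ENNReal.ofReal_coe_nnreal, ← ENNReal.ofReal_mul (by positivity),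
            ← ENNReal.ofReal_mul (by positivity)]
          congr 1
          have := ht.1.ne'
          simp only [NNReal.coe_real_pi]
          field_simp
      _ ≤ _ := by
          refine setLIntegral_mono_ae' measurableSet_ball ?_
          filter_upwards [compl_mem_ae_iff.2 (measure_singleton z₀)] with z hz hzt
          have h1 := (hrb z (ball_subset_ball ht.2.le hzt)).2 hz
          have h2 : ‖z - z₀‖ < t := by simpa [dist_eq_norm] using hzt
          rw [← ofReal_norm, ← ENNReal.ofReal_pow (norm_nonneg _)]
          have h4 := ht.1
          gcongr
          rw [inv_le_iff_one_le_mul₀ (by positivity)]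
          calc 1 ≤ C * (‖h z‖ * ‖z - z₀‖) := h1
            _ ≤ C * (‖h z‖ * t) := by gcongr
            _ = _ := by ring
  have hvol : Tendsto ((volume.restrict s) ∘ fun t : ℝ => ball z₀ t) (𝓝[>] 0) (𝓝 0) := by
    have h1 : Tendsto (fun t : ℝ => ENNReal.ofReal t ^ 2 * NNReal.pi) (𝓝[>] 0) (𝓝 0) := by
      have : Tendsto (fun t : ℝ => ENNReal.ofReal t ^ 2 * NNReal.pi) (𝓝 0)
          (𝓝 (ENNReal.ofReal 0 ^ 2 * NNReal.pi)) :=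
        ENNReal.Tendsto.mul_const
          (((ENNReal.continuous_pow 2).comp ENNReal.continuous_ofReal).tendsto 0) (by simp)
      simpa using this.mono_left nhdsWithin_le_nhds
    refine tendsto_of_tendsto_of_tendsto_of_le_of_le tendsto_const_nhds h1 (fun _ => zero_le) ?_
    intro t
    simpa only [Complex.volume_ball] using! Measure.restrict_apply_le (μ := volume) s (ball z₀ t)
  have hlim := tendsto_setLIntegral_zero hint hvol
  have hle := ge_of_tendsto hlim (mem_of_superset (Ioo_mem_nhdsGT hr) hball)
  have : 0 < C⁻¹ ^ 2 * Real.pi := by positivity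
  exact this.not_ge (ENNReal.ofReal_eq_zero.1 (le_zero_iff.1 hle))

open Filter Topology Metric Set in
/-- Mean value property of a quotient of holomorphic functions that is square integrable
on the disc. -/
theorem circleAverage_div_of_lintegral_sq_ne_top {f g : ℂ → ℂ} {U : Set ℂ} {c : ℂ} {r : ℝ}
    (hU : IsOpen U) (hr : 0 < r) (hrU : closedBall c r ⊆ U)
    (hf : DifferentiableOn ℂ f U) (hg : DifferentiableOn ℂ g U)
    (hgs : ∀ z ∈ sphere c r, g z ≠ 0) (hgc : g c ≠ 0)
    (hint : ∫⁻ z in ball c r, ‖f z / g z‖ₑ ^ 2 ≠ ⊤) :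
    Real.circleAverage (fun z => f z / g z) c r = f c / g c := by
  have hfa : ∀ z ∈ U, AnalyticAt ℂ f z := fun z hz => hf.analyticAt (hU.mem_nhds hz)
  have hga : ∀ z ∈ U, AnalyticAt ℂ g z := fun z hz => hg.analyticAt (hU.mem_nhds hz)
  have hm : MeromorphicOn (fun z => f z / g z) U :=
    fun z hz => (hfa z hz).meromorphicAt.fun_div (hga z hz).meromorphicAt
  set q := toMeromorphicNFOn (fun z => f z / g z) U with hq
  have hq_eq : ∀ z ∈ U, g z ≠ 0 → q z = f z / g z := by
    intro z hz hgz
    rw [hq, toMeromorphicNFOn_eq_toMeromorphicNFAt hm hz, toMeromorphicNFAt_eq_self.2]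
    exact ((hfa z hz).fun_div (hga z hz) hgz).meromorphicNFAt
  have hq_an : ∀ z ∈ closedBall c r, AnalyticAt ℂ q z := by
    intro z hz
    have hzU := hrU hz
    have hnf := meromorphicNFOn_toMeromorphicNFOn (fun z => f z / g z) U hzU
    refine hnf.meromorphicOrderAt_nonneg_iff_analyticAt.1 ?_
    rw [meromorphicOrderAt_toMeromorphicNFOn hm hzU]
    by_cases hgz : g z = 0
    · have hzb : z ∈ ball c r := by
        rw [mem_ball]
        exact lt_of_le_of_ne hz fun h => hgs z h hgz
      exact meromorphicOrderAt_nonneg_of_lintegral_sq_ne_top (hm z hzU)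
        (isOpen_ball.mem_nhds hzb) hint
    · exact ((hfa z hzU).fun_div (hga z hzU) hgz).meromorphicOrderAt_nonneg
  have hmean : Real.circleAverage q c r = q c := by
    apply circleAverage_of_differentiable_on_off_countable countable_empty
    · rw [abs_of_pos hr]
      exact fun z hz => (hq_an z hz).continuousAt.continuousWithinAt
    · rw [abs_of_pos hr]
      exact fun z hz => (hq_an z (ball_subset_closedBall hz.1)).differentiableAt
  rw [← hq_eq c (hrU (mem_closedBall_self hr.le)) hgc, ← hmean]
  refine Real.circleAverage_congr_sphere fun z hz => ?_
  rw [abs_of_pos hr] at hz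
  exact (hq_eq z (hrU (sphere_subset_closedBall hz)) (hgs z hz)).symm

open Filter Topology Metric Set in
/-- Circle averages of a holomorphic function of several variables along a fixed complex direction
depend holomorphically on the centre. -/
theorem differentiableAt_circleAverage_comp_add_smul {E : Type*} [NormedAddCommGroup E]
    [NormedSpace ℂ E] [FiniteDimensional ℂ E] {h : E → ℂ} {Ω : Set E} (hΩ : IsOpen Ω)
    (hh : DifferentiableOn ℂ h Ω) {v w₀ : E} {r : ℝ}
    (hw₀ : ∀ ζ ∈ sphere (0 : ℂ) |r|, w₀ + ζ • v ∈ Ω) :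
    DifferentiableAt ℂ (fun w => Real.circleAverage (fun ζ : ℂ => h (w + ζ • v)) 0 r) w₀ := by
  borelize E
  have : ProperSpace E := FiniteDimensional.proper ℂ E
  set K : Set E := (fun ζ : ℂ => w₀ + ζ • v) '' sphere 0 |r|
  have hKc : IsCompact K := (isCompact_sphere _ _).image (by fun_prop)
  obtain ⟨δ, hδ, hδΩ⟩ := hKc.exists_cthickening_subset_open hΩ (by
    rintro _ ⟨ζ, hζ, rfl⟩; exact hw₀ ζ hζ)
  obtain ⟨M, hM⟩ := (hKc.cthickening (r := δ)).exists_bound_of_continuousOn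
    (hh.continuousOn.mono hδΩ)
  have hmem : ∀ x ∈ ball w₀ (δ / 2), ∀ θ : ℝ,
      ball (x + circleMap 0 r θ • v) (δ / 2) ⊆ cthickening δ K := by
    intro x hx θ y hy
    refine thickening_subset_cthickening _ _ (mem_thickening_iff.2
      ⟨w₀ + circleMap 0 r θ • v, ⟨_, circleMap_mem_sphere' 0 r θ, rfl⟩, ?_⟩)
    calc dist y (w₀ + circleMap 0 r θ • v)
        ≤ dist y (x + circleMap 0 r θ • v) +
            dist (x + circleMap 0 r θ • v) (w₀ + circleMap 0 r θ • v) := dist_triangle _ _ _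
      _ < δ / 2 + δ / 2 := by
          rw [dist_add_right]
          exact add_lt_add hy hx
      _ = δ := by ring
  have hself : ∀ x ∈ ball w₀ (δ / 2), ∀ θ : ℝ, x + circleMap 0 r θ • v ∈ Ω := fun x hx θ =>
    hδΩ (hmem x hx θ (mem_ball_self (half_pos hδ)))
  have hcont : ∀ x ∈ ball w₀ (δ / 2), Continuous fun θ : ℝ => h (x + circleMap 0 r θ • v) := by
    intro x hx
    refine hh.continuousOn.comp_continuous ?_ (hself x hx)
    have := continuous_circleMap 0 r
    fun_prop
  have hdiff := intervalIntegral.hasFDerivAt_integral_of_dominated_of_fderiv_le (𝕜 := ℂ)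
    (μ := volume) (a := 0) (b := 2 * Real.pi) (s := ball w₀ (δ / 2)) (x₀ := w₀)
    (F := fun w θ => h (w + circleMap 0 r θ • v))
    (F' := fun w θ => fderiv ℂ h (w + circleMap 0 r θ • v))
    (bound := fun _ => (2 * M) / (δ / 2))
    (ball_mem_nhds _ (half_pos hδ))
    (by
      filter_upwards [ball_mem_nhds w₀ (half_pos hδ)] with x hx
      exact (hcont x hx).aestronglyMeasurable)
    ((hcont w₀ (mem_ball_self (half_pos hδ))).intervalIntegrable _ _)
    (by
      have : Measurable fun θ : ℝ => fderiv ℂ h (w₀ + circleMap 0 r θ • v) := by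
        refine (measurable_fderiv ℂ h).comp (Continuous.measurable ?_)
        have := continuous_circleMap 0 r
        fun_prop
      exact this.aestronglyMeasurable)
    (by
      refine Eventually.of_forall fun θ _ x hx => ?_
      refine Complex.norm_fderiv_le_div_of_mapsTo_ball
        (hh.mono ((hmem x hx θ).trans hδΩ)) (fun y hy => ?_) (half_pos hδ)
      rw [mem_closedBall, dist_eq_norm]
      refine (norm_sub_le _ _).trans ?_
      have h1 := hM y (hmem x hx θ hy)
      have h2 := hM _ (hmem x hx θ (mem_ball_self (half_pos hδ)))
      linarith)
    intervalIntegrable_const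
    (by
      refine Eventually.of_forall fun θ _ x hx => ?_
      exact (hasFDerivAt_comp_add_right _).2
        (hh.differentiableAt (hΩ.mem_nhds (hself x hx θ))).hasFDerivAt)
  simp only [Real.circleAverage_def]
  exact hdiff.differentiableAt.const_smul _

open Filter Topology Metric Set in
/-- A holomorphic function on a convex open set that vanishes near one point of a complex line
vanishes on the part of that line in the set. -/
theorem eq_zero_of_eventually_eq_zero_on_line {E : Type*} [NormedAddCommGroup E]
    [NormedSpace ℂ E] {g : E → ℂ} {s : Set E} (hs : IsOpen s) (hconv : Convex ℝ s)
    (hg : DifferentiableOn ℂ g s) {a b : E} (ha : a ∈ s) (hb : b ∈ s)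
    (h0 : ∀ᶠ ζ : ℂ in 𝓝 0, g (a + ζ • (b - a)) = 0) : g b = 0 := by
  set L : ℂ → E := fun ζ => a + ζ • (b - a) with hL
  have hLd : Differentiable ℂ L := by fun_prop
  have hopen : IsOpen (L ⁻¹' s) := hs.preimage hLd.continuous
  have hcv : Convex ℝ (L ⁻¹' s) := by
    intro x hx y hy p q hp hq hpq
    have : L (p • x + q • y) = p • L x + q • L y := by
      have ha' : a = p • a + q • a := by rw [← add_smul, hpq, one_smul]
      simp only [hL, smul_add, add_smul, smul_assoc]
      nth_rewrite 1 [ha']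
      abel
    rw [mem_preimage, this]
    exact hconv hx hy hp hq hpq
  have han : AnalyticOnNhd ℂ (g ∘ L) (L ⁻¹' s) :=
    (hg.comp hLd.differentiableOn (mapsTo_preimage L s)).analyticOnNhd hopen
  have := han.eqOn_zero_of_preconnected_of_eventuallyEq_zero hcv.isPreconnected
    (z₀ := 0) (by simpa [hL] using ha) h0 (x := 1) (by simpa [hL] using hb)
  simpa [hL] using this

open Filter Topology Metric Set in
/-- A holomorphic function on a domain that is not identically zero vanishes on no open subset. -/
theorem frequently_ne_zero_of_differentiableOn {E : Type*} [NormedAddCommGroup E]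
    [NormedSpace ℂ E] {g : E → ℂ} {D : Set E} (hD : IsOpen D) (hDc : IsPreconnected D)
    (hg : DifferentiableOn ℂ g D) (hne : ∃ z ∈ D, g z ≠ 0) {z : E} (hz : z ∈ D) :
    ∃ᶠ w in 𝓝 z, g w ≠ 0 := by
  intro hzero
  simp only [not_not] at hzero
  set A : Set E := {x | ∀ᶠ w in 𝓝 x, g w = 0}
  have hAo : IsOpen A := isOpen_setOfPred_eventually_nhds
  have hsub : D ⊆ A := by
    refine hDc.subset_of_closure_inter_subset hAo ⟨z, hz, hzero⟩ ?_
    rintro x ⟨hxA, hxD⟩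
    obtain ⟨r, hr, hrD⟩ := Metric.isOpen_iff.1 hD x hxD
    obtain ⟨a, haA, hax⟩ := Metric.mem_closure_iff.1 hxA r hr
    have hab : a ∈ ball x r := by rwa [mem_ball, dist_comm]
    filter_upwards [ball_mem_nhds x hr] with w hw
    refine eq_zero_of_eventually_eq_zero_on_line isOpen_ball (convex_ball x r) (hg.mono hrD)
      hab hw ?_
    have hcont : Tendsto (fun ζ : ℂ => a + ζ • (w - a)) (𝓝 0) (𝓝 a) := by
      have : Continuous fun ζ : ℂ => a + ζ • (w - a) := by fun_prop
      simpa using this.tendsto 0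
    exact hcont.eventually haA
  obtain ⟨w, hw, hgw⟩ := hne
  exact hgw (hsub hw).self_of_nhds

/-- The complement of the zero set of a continuous function on an open set is open. -/
theorem isOpen_diff_zeros {E : Type*} [TopologicalSpace E] {g : E → ℂ} {D : Set E}
    (hD : IsOpen D) (hg : ContinuousOn g D) : IsOpen (D \ {z ∈ D | g z = 0}) := by
  convert hg.isOpen_inter_preimage hD (isOpen_compl_singleton (x := (0 : ℂ))) using 1
  ext w
  simp only [Set.mem_sdiff, Set.mem_ofPred_eq, Set.mem_inter_iff, Set.mem_preimage,
    Set.mem_compl_iff, Set.mem_singleton_iff]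
  tauto

open Filter Topology Metric Set in
/-- A square integrable function is square integrable along almost every complex line in a
given direction. -/
theorem ae_lintegral_sq_comp_add_smul_lt_top {E : Type*} [NormedAddCommGroup E]
    [NormedSpace ℂ E] [FiniteDimensional ℂ E] [MeasurableSpace E] [BorelSpace E] {μ : Measure E}
    [μ.IsAddHaarMeasure] {F : E → ENNReal} (hF : Measurable F) (hint : ∫⁻ w, F w ∂μ ≠ ⊤)
    (v : E) (r : ℝ) : ∀ᵐ w ∂μ, ∫⁻ ζ in ball (0 : ℂ) r, F (w + ζ • v) < ⊤ := by
  have : ProperSpace E := FiniteDimensional.proper ℂ E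
  have hmeas : Measurable fun p : E × ℂ => F (p.1 + p.2 • v) :=
    hF.comp (by fun_prop : Continuous fun p : E × ℂ => p.1 + p.2 • v).measurable
  refine ae_lt_top hmeas.lintegral_prod_right' ?_
  rw [lintegral_lintegral_swap hmeas.aemeasurable]
  simp only [lintegral_add_right_eq_self (μ := μ) F, setLIntegral_const]
  exact ENNReal.mul_ne_top hint measure_ball_lt_top.ne

open Filter Topology Metric Set in
/-- A quotient of holomorphic functions that is square integrable near a point is locally
holomorphic there. -/
theorem exists_holomorphic_quotient_nhds {E : Type*} [NormedAddCommGroup E]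
    [NormedSpace ℂ E] [FiniteDimensional ℂ E] [MeasurableSpace E] [BorelSpace E] {μ : Measure E}
    [μ.IsAddHaarMeasure] {f g : E → ℂ} {z₀ : E} {R : ℝ} (hR : 0 < R)
    (hf : DifferentiableOn ℂ f (ball z₀ R)) (hg : DifferentiableOn ℂ g (ball z₀ R))
    (hne : ∀ z ∈ ball z₀ R, ∃ᶠ w in 𝓝 z, g w ≠ 0)
    (hint : ∫⁻ w in ball z₀ R, ‖f w / g w‖ₑ ^ 2 ∂μ ≠ ⊤) :
    ∃ V, IsOpen V ∧ z₀ ∈ V ∧ ∃ H : E → ℂ, DifferentiableOn ℂ H V ∧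
      ∀ w ∈ V, H w * g w = f w := by
  have : ProperSpace E := FiniteDimensional.proper ℂ E
  set B := ball z₀ R with hB
  have hz₀ : z₀ ∈ B := mem_ball_self hR
  obtain ⟨b, hgb, hbB⟩ := ((hne z₀ hz₀).and_eventually (isOpen_ball.mem_nhds hz₀)).exists
  set v := b - z₀ with hv
  have hvR : ‖v‖ < R := by rw [hv, ← dist_eq_norm]; exact hbB
  obtain ⟨r₀, hr₀, hgr₀⟩ : ∃ r₀ > 0, ∀ ζ ∈ ball (0 : ℂ) r₀, ζ ≠ 0 → g (z₀ + ζ • v) ≠ 0 := by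
    have hline : Differentiable ℂ fun ζ : ℂ => z₀ + ζ • v := by fun_prop
    have han : AnalyticAt ℂ (fun ζ : ℂ => g (z₀ + ζ • v)) 0 := by
      refine (hg.comp hline.differentiableOn (mapsTo_preimage _ B)).analyticAt
        ((isOpen_ball.preimage hline.continuous).mem_nhds ?_)
      simpa only [mem_preimage, zero_smul, add_zero] using hz₀
    rcases han.eventually_eq_zero_or_eventually_ne_zero with h | h
    · exact absurd (eq_zero_of_eventually_eq_zero_on_line isOpen_ball (convex_ball z₀ R) hg hz₀
        hbB h) hgb
    · exact Metric.eventually_nhds_iff_ball.1 (eventually_nhdsWithin_iff.1 h)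
  obtain ⟨r, hr, hr1, hrr₀⟩ : ∃ r : ℝ, 0 < r ∧ r < 1 ∧ r < r₀ := by
    obtain ⟨r, h0, h1⟩ := exists_between (lt_min one_pos hr₀)
    exact ⟨r, h0, h1.trans_le (min_le_left _ _), h1.trans_le (min_le_right _ _)⟩
  set Ω := B ∩ {w | g w ≠ 0}
  have hΩ : IsOpen Ω := hg.continuousOn.isOpen_inter_preimage isOpen_ball isOpen_compl_singleton
  set K : Set E := (fun ζ : ℂ => z₀ + ζ • v) '' sphere 0 r
  have hKc : IsCompact K := (isCompact_sphere _ _).image (by fun_prop)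
  have hKΩ : K ⊆ Ω := by
    rintro _ ⟨ζ, hζ, rfl⟩
    have hζr : ‖ζ‖ = r := by simpa using hζ
    refine ⟨?_, hgr₀ ζ (by simpa [hζr] using hrr₀) (norm_pos_iff.1 (hζr ▸ hr))⟩
    rw [hB, mem_ball, dist_eq_norm, add_sub_cancel_left, norm_smul, hζr]
    nlinarith [norm_nonneg v]
  obtain ⟨δ₁, hδ₁, hδ₁Ω⟩ := hKc.exists_thickening_subset_open hΩ hKΩ
  obtain ⟨δ, hδ, hδδ₁, hδR⟩ : ∃ δ : ℝ, 0 < δ ∧ δ ≤ δ₁ ∧ δ ≤ R - ‖v‖ :=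
    ⟨min δ₁ (R - ‖v‖), lt_min hδ₁ (sub_pos.2 hvR), min_le_left _ _, min_le_right _ _⟩
  have hsphere : ∀ w ∈ ball z₀ δ, ∀ ζ ∈ sphere (0 : ℂ) r, w + ζ • v ∈ Ω := by
    intro w hw ζ hζ
    refine hδ₁Ω (mem_thickening_iff.2 ⟨z₀ + ζ • v, ⟨ζ, hζ, rfl⟩, ?_⟩)
    rw [dist_add_right]
    exact lt_of_lt_of_le hw hδδ₁
  have hdisc : ∀ w ∈ ball z₀ δ, ∀ ζ ∈ closedBall (0 : ℂ) r, w + ζ • v ∈ B := by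
    intro w hw ζ hζ
    have hζr : ‖ζ‖ ≤ r := by simpa using hζ
    have hwδ : ‖w - z₀‖ < δ := by simpa [dist_eq_norm] using hw
    rw [hB, mem_ball, dist_eq_norm, add_sub_right_comm]
    calc ‖w - z₀ + ζ • v‖ ≤ ‖w - z₀‖ + ‖ζ‖ * ‖v‖ := (norm_add_le _ _).trans_eq (by rw [norm_smul])
      _ ≤ ‖w - z₀‖ + 1 * ‖v‖ := by gcongr; exact hζr.trans hr1.le
      _ < R := by linarith
  have hVB : ball z₀ δ ⊆ B := fun w hw => by
    simpa using hdisc w hw 0 (mem_closedBall_self hr.le)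
  set H : E → ℂ := fun w => Real.circleAverage (fun ζ : ℂ => f (w + ζ • v) / g (w + ζ • v)) 0 r
    with hHdef
  have hquot : DifferentiableOn ℂ (fun w => f w / g w) Ω :=
    by
      simp only [div_eq_mul_inv]
      exact (hf.mono inter_subset_left).fun_mul
        ((hg.mono inter_subset_left).fun_inv fun w hw => hw.2)
  have hHdiff : DifferentiableOn ℂ H (ball z₀ δ) := fun w hw =>
    (differentiableAt_circleAverage_comp_add_smul hΩ hquot (by
      rw [abs_of_pos hr]; exact hsphere w hw)).differentiableWithinAt
  have hae : ∀ᵐ w ∂μ, w ∈ ball z₀ δ → g w ≠ 0 → H w * g w = f w := by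
    have hFm : Measurable (B.indicator fun w => ‖f w / g w‖ₑ ^ 2) := by
      have hfm : Measurable (B.indicator f) := by
        classical
        rw [← piecewise_eq_indicator]
        exact hf.continuousOn.measurable_piecewise continuousOn_const measurableSet_ball
      have hgm : Measurable (B.indicator g) := by
        classical
        rw [← piecewise_eq_indicator]
        exact hg.continuousOn.measurable_piecewise continuousOn_const measurableSet_ball
      convert ((hfm.div hgm).enorm.pow_const 2) using 1
      ext w
      by_cases hw : w ∈ B <;> simp [hw]
    have hFi : ∫⁻ w, B.indicator (fun w => ‖f w / g w‖ₑ ^ 2) w ∂μ ≠ ⊤ := by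
      rwa [lintegral_indicator measurableSet_ball]
    filter_upwards [ae_lintegral_sq_comp_add_smul_lt_top hFm hFi v r] with w hw hwV hgw
    have hline : Differentiable ℂ fun ζ : ℂ => w + ζ • v := by fun_prop
    have hmean := circleAverage_div_of_lintegral_sq_ne_top
      (f := fun ζ : ℂ => f (w + ζ • v)) (g := fun ζ : ℂ => g (w + ζ • v))
      (U := (fun ζ : ℂ => w + ζ • v) ⁻¹' B) (c := 0) (isOpen_ball.preimage hline.continuous) hr
      (hdisc w hwV) (hf.comp hline.differentiableOn (mapsTo_preimage _ B))
      (hg.comp hline.differentiableOn (mapsTo_preimage _ B))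
      (fun ζ hζ => (hsphere w hwV ζ hζ).2) (by simpa using hgw) (by
        refine ne_of_eq_of_ne (setLIntegral_congr_fun measurableSet_ball fun ζ hζ => ?_) hw.ne
        exact (indicator_of_mem (hdisc w hwV ζ (ball_subset_closedBall hζ))
          fun w => ‖f w / g w‖ₑ ^ 2).symm)
    simp only [zero_smul, add_zero] at hmean
    rw [hHdef]
    simp only [hmean]
    exact div_mul_cancel₀ _ hgw
  refine ⟨ball z₀ δ, isOpen_ball, mem_ball_self hδ, H, hHdiff, fun w hw => ?_⟩
  by_contra hwne
  have hcont : ContinuousOn (fun w => H w * g w - f w) (ball z₀ δ) :=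
    (hHdiff.continuousOn.mul (hg.continuousOn.mono hVB)).sub (hf.continuousOn.mono hVB)
  have hev : ∀ᶠ x in 𝓝 w, H x * g x - f x ≠ 0 :=
    (hcont.continuousAt (isOpen_ball.mem_nhds hw)).eventually_ne (sub_ne_zero.2 hwne)
  obtain ⟨x, hgx, hxne, hxV⟩ := ((hne w (hVB hw)).and_eventually
    ((eventually_eventually_nhds.2 hev).and (isOpen_ball.mem_nhds hw))).exists
  have hgx' : ∀ᶠ y in 𝓝 x, g y ≠ 0 :=
    (hg.continuousOn.continuousAt (isOpen_ball.mem_nhds (hVB hxV))).eventually_ne hgx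
  obtain ⟨y, hy, hyne, hgy, hyV⟩ := (Measure.dense_of_ae hae).inter_nhds_nonempty
    (inter_mem hxne (inter_mem hgx' (isOpen_ball.mem_nhds hxV)))
  exact hyne (sub_eq_zero.2 (hy hyV hgy))

open Filter Topology Metric Set in
/-- A quotient of holomorphic functions on a domain that is locally square integrable is
holomorphic on the domain. -/
theorem exists_holomorphic_quotient {E : Type*} [NormedAddCommGroup E]
    [NormedSpace ℂ E] [FiniteDimensional ℂ E] [MeasurableSpace E] [BorelSpace E] {μ : Measure E}
    [μ.IsAddHaarMeasure] {f g : E → ℂ} {D : Set E} (hD : IsOpen D) (hDc : IsPreconnected D)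
    (hf : DifferentiableOn ℂ f D) (hg : DifferentiableOn ℂ g D) (hgne : ∃ z ∈ D, g z ≠ 0)
    (hint : ∀ z ∈ D, ∃ s ∈ 𝓝 z, ∫⁻ w in s, ‖f w / g w‖ₑ ^ 2 ∂μ ≠ ⊤) :
    ∃ H : E → ℂ, DifferentiableOn ℂ H D ∧ ∀ z ∈ D, H z * g z = f z := by
  have hne : ∀ z ∈ D, ∃ᶠ w in 𝓝 z, g w ≠ 0 := fun z hz =>
    frequently_ne_zero_of_differentiableOn hD hDc hg hgne hz
  have hloc : ∀ z ∈ D, ∃ V, IsOpen V ∧ z ∈ V ∧ ∃ H : E → ℂ, DifferentiableOn ℂ H V ∧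
      ∀ w ∈ V, H w * g w = f w := by
    intro z hz
    obtain ⟨s, hs, hsint⟩ := hint z hz
    obtain ⟨R, hR, hRs⟩ := Metric.mem_nhds_iff.1 (inter_mem (hD.mem_nhds hz) hs)
    have hRD : ball z R ⊆ D := hRs.trans inter_subset_left
    exact exists_holomorphic_quotient_nhds hR (hf.mono hRD) (hg.mono hRD)
      (fun w hw => hne w (hRD hw))
      (ne_top_of_le_ne_top hsint (lintegral_mono_set (hRs.trans inter_subset_right)))
  choose! V hVo hzV H hHd hHg using hloc
  have hHeq : ∀ z ∈ D, ∀ w ∈ D, w ∈ V z → H w w = H z w := by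
    intro z hz w hw hwz
    by_contra hneq
    have hcont : ∀ x ∈ D, w ∈ V x → ContinuousAt (H x) w := fun x hx hwx =>
      ((hHd x hx).differentiableAt ((hVo x hx).mem_nhds hwx)).continuousAt
    have hev : ∀ᶠ x in 𝓝 w, H w x - H z x ≠ 0 :=
      ((hcont w hw (hzV w hw)).sub (hcont z hz hwz)).eventually_ne (sub_ne_zero.2 hneq)
    obtain ⟨x, hgx, hx, hxw, hxz⟩ := ((hne w hw).and_eventually
      (hev.and ((inter_mem ((hVo w hw).mem_nhds (hzV w hw)) ((hVo z hz).mem_nhds hwz))))).exists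
    refine hx (sub_eq_zero.2 (mul_right_cancel₀ hgx ?_))
    rw [hHg w hw x hxw, hHg z hz x hxz]
  refine ⟨fun z => H z z, fun z hz => ?_, fun z hz => hHg z hz z (hzV z hz)⟩
  refine (DifferentiableAt.congr_of_eventuallyEq
    ((hHd z hz).differentiableAt ((hVo z hz).mem_nhds (hzV z hz))) ?_).differentiableWithinAt
  filter_upwards [hD.mem_nhds hz, (hVo z hz).mem_nhds (hzV z hz)] with w hw hwz
  exact hHeq z hz w hw hwz

open Filter Topology Metric Set in
/-- The weighted `L²` condition on a dividend makes the quotient locally square integrable. -/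
theorem exists_nhds_lintegral_sq_div_ne_top {E : Type*} [TopologicalSpace E] [MeasurableSpace E]
    [OpensMeasurableSpace E] {μ : Measure E} {f g : E → ℂ} {φ : E → ℝ} {D : Set E}
    (hD : IsOpen D) (hφ : UpperSemicontinuousOn φ D) (hg : ContinuousOn g D) {ε : ℝ} (hε : 0 < ε)
    (hint : IntegrableOn
      (fun z => ‖f z‖ ^ 2 * Real.exp (-φ z) * ‖g z‖ ^ (-(2 * (1 + ε))))
      (D \ {z ∈ D | g z = 0}) μ) {z : E} (hz : z ∈ D) :
    ∃ s ∈ 𝓝 z, ∫⁻ w in s, ‖f w / g w‖ₑ ^ 2 ∂μ ≠ ⊤ := by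
  set W := D \ {z ∈ D | g z = 0}
  have hφev : ∀ᶠ w in 𝓝 z, φ w < φ z + 1 := by
    have := hφ z hz (φ z + 1) (lt_add_one _)
    rwa [hD.nhdsWithin_eq hz] at this
  have hgev : ∀ᶠ w in 𝓝 z, ‖g w‖ < ‖g z‖ + 1 :=
    (hg.continuousAt (hD.mem_nhds hz)).norm.eventually (gt_mem_nhds (lt_add_one _))
  obtain ⟨s, hsub, hso, hzs⟩ := mem_nhds_iff.1 (inter_mem (hD.mem_nhds hz) (hφev.and hgev))
  refine ⟨s, hso.mem_nhds hzs, ?_⟩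
  set M := ‖g z‖ + 1
  have hMpos : 0 < M := by positivity
  set c := Real.exp (φ z + 1) * M ^ (2 * ε) with hc
  have hWm : MeasurableSet W := (isOpen_diff_zeros hD hg).measurableSet
  refine ne_top_of_le_ne_top (ENNReal.mul_ne_top (ENNReal.ofReal_ne_top (r := c))
    hint.hasFiniteIntegral.ne) ?_
  rw [← lintegral_const_mul' _ _ ENNReal.ofReal_ne_top, ← lintegral_indicator hso.measurableSet,
    ← lintegral_indicator hWm]
  refine lintegral_mono fun w => ?_
  by_cases hws : w ∈ s
  swap
  · simp [hws]
  obtain ⟨hwD, hφw, hgw⟩ := hsub hws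
  by_cases hg0 : g w = 0
  · simp [hws, hg0]
  rw [indicator_of_mem hws, indicator_of_mem (show w ∈ W from ⟨hwD, fun h => hg0 h.2⟩)]
  have hgpos : 0 < ‖g w‖ := norm_pos_iff.2 hg0
  rw [← ofReal_norm, ← ENNReal.ofReal_pow (norm_nonneg _),
    Real.enorm_of_nonneg (by positivity), ← ENNReal.ofReal_mul (by positivity)]
  refine ENNReal.ofReal_le_ofReal ?_
  have hexp : ‖g w‖ ^ (-(2 * (1 + ε))) = (‖g w‖ ^ 2)⁻¹ * (‖g w‖ ^ (2 * ε))⁻¹ := by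
    rw [show -(2 * (1 + ε)) = -(2 : ℕ) + -(2 * ε) by push_cast; ring, Real.rpow_add hgpos,
      Real.rpow_neg hgpos.le, Real.rpow_neg hgpos.le, Real.rpow_natCast]
  have h1 : 1 ≤ Real.exp (φ z + 1) * Real.exp (-φ w) := by
    rw [← Real.exp_add]
    exact Real.one_le_exp (by linarith)
  have h2 : 1 ≤ M ^ (2 * ε) * (‖g w‖ ^ (2 * ε))⁻¹ := by
    rw [← div_eq_mul_inv, one_le_div (by positivity)]
    exact Real.rpow_le_rpow hgpos.le hgw.le (by positivity)
  calc ‖f w / g w‖ ^ 2 = ‖f w‖ ^ 2 * (‖g w‖ ^ 2)⁻¹ * (1 * 1) := by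
        rw [norm_div, div_pow, div_eq_mul_inv]; ring
    _ ≤ ‖f w‖ ^ 2 * (‖g w‖ ^ 2)⁻¹ * ((Real.exp (φ z + 1) * Real.exp (-φ w)) *
          (M ^ (2 * ε) * (‖g w‖ ^ (2 * ε))⁻¹)) := by gcongr
    _ = _ := by simp only [hexp, hc]; ring

/-- **The `p = 1` case of the Skoda-type L² division theorem (Theorem 1.2).**
If `f`, `g` are holomorphic on a domain `D ⊆ ℂⁿ`, `g ≢ 0`, `φ` is upper
semicontinuous on `D` and `∫_{D∖Z} |f|² e^{-φ} |g|^{-2(1+ε)} < ∞`, then `f` is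
divisible by `g` with a holomorphic quotient `H` satisfying
`∫_{D∖Z} |H|² e^{-φ} |g|^{-2ε} = ∫_{D∖Z} |f|² e^{-φ} |g|^{-2(1+ε)}`,
in particular the left-hand integral is finite. -/
theorem skoda_division_one_divisor
    (n : ℕ) (hn : 1 ≤ n) (D : Set (Fin n → ℂ)) (hD : IsOpen D)
    (hDne : D.Nonempty) (hDconn : IsConnected D)
    (φ : (Fin n → ℂ) → ℝ) (hφ : UpperSemicontinuousOn φ D)
    (g f : (Fin n → ℂ) → ℂ) (hg : DifferentiableOn ℂ g D)
    (hf : DifferentiableOn ℂ f D) (hgne : ∃ z ∈ D, g z ≠ 0)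
    (ε : ℝ) (hε : 0 < ε)
    (hint : IntegrableOn
      (fun z => ‖f z‖ ^ 2 * Real.exp (-φ z) * ‖g z‖ ^ (-(2 * (1 + ε))))
      (D \ {z ∈ D | g z = 0}) volume) :
    ∃ H : (Fin n → ℂ) → ℂ, DifferentiableOn ℂ H D ∧
      (∀ z ∈ D, H z * g z = f z) ∧
      IntegrableOn (fun z => ‖H z‖ ^ 2 * Real.exp (-φ z) * ‖g z‖ ^ (-(2 * ε)))
        (D \ {z ∈ D | g z = 0}) volume ∧
      ∫ z in D \ {z ∈ D | g z = 0},
          ‖H z‖ ^ 2 * Real.exp (-φ z) * ‖g z‖ ^ (-(2 * ε)) ∂volume =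
        ∫ z in D \ {z ∈ D | g z = 0},
          ‖f z‖ ^ 2 * Real.exp (-φ z) * ‖g z‖ ^ (-(2 * (1 + ε))) ∂volume := by
  obtain ⟨H, hH, hHg⟩ := exists_holomorphic_quotient (μ := volume) hD hDconn.isPreconnected hf hg
    hgne fun z hz => exists_nhds_lintegral_sq_div_ne_top hD hφ hg.continuousOn hε hint hz
  have hmeas : MeasurableSet (D \ {z ∈ D | g z = 0}) :=
    (isOpen_diff_zeros hD hg.continuousOn).measurableSet
  have heq : Set.EqOn (fun z => ‖f z‖ ^ 2 * Real.exp (-φ z) * ‖g z‖ ^ (-(2 * (1 + ε))))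
      (fun z => ‖H z‖ ^ 2 * Real.exp (-φ z) * ‖g z‖ ^ (-(2 * ε)))
      (D \ {z ∈ D | g z = 0}) := by
    rintro z ⟨hzD, hz⟩
    have hgpos : 0 < ‖g z‖ := norm_pos_iff.2 fun h => hz ⟨hzD, h⟩
    simp only [← hHg z hzD, norm_mul]
    rw [show -(2 * (1 + ε)) = -(2 : ℕ) + -(2 * ε) by push_cast; ring, Real.rpow_add hgpos,
      Real.rpow_neg hgpos.le, Real.rpow_natCast]
    field_simp
  exact ⟨H, hH, hHg, hint.congr_fun heq hmeas, (setIntegral_congr_fun hmeas heq).symm⟩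
end
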